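/- For every real a > 0 and every real β ≥ 1 + a there exists an integer n₀ such that for all integers n ≥ n₀ and all integers k with 1 ≤ k ≤ lg n − 2 the following holds: if each of n balls independently chooses a bin uniformly at random from {1,…,⌊2^k/(βk)⌋} and, independently, a label uniformly at random from {1,…,⌊2^{βk}⌋}, then the probability that every bin contains balls carrying at most βk distinct labels is smaller than n^{−a}. -/

import Mathlib

open scoped Classical

open Finset in
/-- The number of functions whose range has at most `N` elements is at most
`(card α).choose N * N ^ n`. -/
theorem card_filter_card_image_le {n N : ℕ} {α : Type*} [Fintype α] [DecidableEq α]
    (hN : N ≤ Fintype.card α) :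
    (univ.filter (fun X : Fin n → α => (univ.image X).card ≤ N)).card
      ≤ (Fintype.card α).choose N * N ^ n := by
  have hsub : univ.filter (fun X : Fin n → α => (univ.image X).card ≤ N) ⊆
      (powersetCard N (univ : Finset α)).biUnion
        (fun T => Fintype.piFinset (fun _ : Fin n => T)) := by
    intro X hX
    obtain ⟨T, hT, -, hc⟩ := exists_subsuperset_card_eq (subset_univ (univ.image X))
      (by simpa using hX) (by simpa using hN)
    simp only [mem_biUnion, mem_powersetCard, Fintype.mem_piFinset]
    exact ⟨T, ⟨subset_univ _, hc⟩, fun i => hT (mem_image_of_mem X (mem_univ i))⟩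
  refine (card_le_card hsub).trans ?_
  refine (card_biUnion_le_card_mul _ _ (N ^ n) ?_).trans ?_
  · intro T hT
    rw [Fintype.card_piFinset_const, (mem_powersetCard.1 hT).2]
  · simp [card_powersetCard]

open Finset in
/-- If every fibre of the first coordinate carries at most `s` second coordinates, then the
range has at most `card β * s` elements. -/
theorem card_image_le_mul_of_card_fiber_image_le {ι β γ : Type*} [Fintype ι] [Fintype β]
    [DecidableEq β] [DecidableEq γ] (X : ι → β × γ) (s : ℕ)
    (h : ∀ b, ((univ.filter (fun i => (X i).1 = b)).image (fun i => (X i).2)).card ≤ s) :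
    (univ.image X).card ≤ Fintype.card β * s := by
  have hsub : univ.image X ⊆ (univ : Finset β).biUnion (fun b =>
      ((univ.filter (fun i => (X i).1 = b)).image (fun i => (X i).2)).image (Prod.mk b)) := by
    intro p hp
    obtain ⟨i, -, rfl⟩ := mem_image.1 hp
    simp only [mem_biUnion, mem_image, mem_filter, mem_univ, true_and]
    exact ⟨(X i).1, (X i).2, ⟨i, rfl, rfl⟩, rfl⟩
  refine (card_le_card hsub).trans ?_
  exact card_biUnion_le_card_mul _ _ s fun b _ => card_image_le.trans (h b)

/-- The union bound `C(A, N) (N / A) ^ n` decays exponentially in `n` when `N ≤ A / 2` and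
`N ≤ n / 4`. -/
theorem choose_mul_pow_div_pow_le {A N n : ℕ} (hA : 0 < A) (hNA : 2 * N ≤ A)
    (hNn : 4 * N ≤ n) :
    ((A.choose N : ℝ) * (N : ℝ) ^ n) / (A : ℝ) ^ n ≤ (2 : ℝ) ^ (-((n : ℝ) / 4)) := by
  have hA' : (0 : ℝ) < A := by exact_mod_cast hA
  have hratio : (N : ℝ) / A ≤ 1 / 2 := by
    rw [div_le_div_iff₀ hA' two_pos]
    have : (2 : ℝ) * N ≤ A := by exact_mod_cast hNA
    linarith
  obtain ⟨d, rfl⟩ := Nat.exists_eq_add_of_le (show N ≤ n by omega)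
  calc ((A.choose N : ℝ) * (N : ℝ) ^ (N + d)) / (A : ℝ) ^ (N + d)
      ≤ ((A : ℝ) ^ N / (N.factorial : ℝ) * (N : ℝ) ^ (N + d)) / (A : ℝ) ^ (N + d) := by
        gcongr
        exact Nat.choose_le_pow_div N A
    _ = ((N : ℝ) ^ N / (N.factorial : ℝ)) * ((N : ℝ) / A) ^ d := by
        rw [pow_add, pow_add, div_pow]
        field_simp
    _ ≤ Real.exp N * (1 / 2) ^ d := by
        gcongr
        exact Real.pow_div_factorial_le_exp _ (Nat.cast_nonneg N) N
    _ ≤ (4 : ℝ) ^ N * (1 / 2) ^ d := by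
        gcongr
        rw [← mul_one (N : ℝ), Real.exp_nat_mul]
        gcongr
        linarith [Real.exp_one_lt_three]
    _ = (2 : ℝ) ^ (2 * (N : ℝ) - d) := by
        rw [Real.rpow_sub two_pos, Real.rpow_mul two_pos.le, Real.rpow_natCast,
          Real.rpow_natCast, one_div, inv_pow, div_eq_mul_inv]
        norm_num
    _ ≤ (2 : ℝ) ^ (-(((N + d : ℕ) : ℝ) / 4)) := by
        apply Real.rpow_le_rpow_of_exponent_le one_le_two
        have : (4 : ℝ) * N ≤ ((N + d : ℕ) : ℝ) := by exact_mod_cast hNn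
        push_cast at this ⊢
        linarith

/-- Exponential decay eventually beats any negative power. -/
theorem eventually_two_rpow_neg_div_four_lt_rpow_neg (a : ℝ) :
    ∀ᶠ n : ℕ in Filter.atTop, (2 : ℝ) ^ (-((n : ℝ) / 4)) < (n : ℝ) ^ (-a) := by
  have h := (tendsto_rpow_mul_exp_neg_mul_atTop_nhds_zero a (Real.log 2 / 4)
    (by positivity)).comp (tendsto_natCast_atTop_atTop (R := ℝ))
  filter_upwards [h.eventually (gt_mem_nhds one_pos), Filter.eventually_gt_atTop 0]
    with n hn hpos
  have hn0 : (0 : ℝ) < n := by exact_mod_cast hpos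
  rw [Real.rpow_neg hn0.le, ← one_div, lt_div_iff₀ (Real.rpow_pos_of_pos hn0 a),
    Real.rpow_def_of_pos two_pos, mul_comm]
  convert hn using 3
  simp only [Function.comp]
  ring_nf

/-- `⌊x⌋ ≤ ⌊2 ^ x⌋ / 2`. -/
theorem two_mul_floor_le_floor_two_rpow {x : ℝ} (hx : 1 ≤ x) :
    2 * ⌊x⌋₊ ≤ ⌊(2 : ℝ) ^ x⌋₊ := by
  have h1 : 1 ≤ ⌊x⌋₊ := (Nat.one_le_floor_iff x).2 hx
  have h2 : 2 * ⌊x⌋₊ ≤ 2 ^ ⌊x⌋₊ := by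
    obtain ⟨m, hm⟩ := Nat.exists_eq_add_of_le' h1
    rw [hm, pow_succ, mul_comm]
    exact Nat.mul_le_mul_right 2 Nat.lt_two_pow_self
  refine h2.trans (Nat.le_floor ?_)
  push_cast
  rw [← Real.rpow_natCast]
  exact Real.rpow_le_rpow_of_exponent_le one_le_two (Nat.floor_le (by linarith))

/-- For every real `a > 0` and every real `β ≥ 1 + a` there exists an integer `n₀` such
that for all integers `n ≥ n₀` and all integers `k` with `1 ≤ k ≤ lg n - 2` the
following holds: if each of `n` balls independently chooses a bin uniformly at random
from `{1,…,⌊2^k/(βk)⌋}` and, independently, a label uniformly at random from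
`{1,…,⌊2^(βk)⌋}` (the outcome is `X : Fin n → Fin ⌊2^k/(βk)⌋₊ × Fin ⌊2^(βk)⌋₊`
distributed according to the product of the uniform distributions), then the probability
that every bin contains balls carrying at most `βk` distinct labels is smaller than
`n ^ (-a)`. -/
theorem few_labels_per_bin_unlikely (a β : ℝ) (ha : 0 < a) (hβ : 1 + a ≤ β) :
    ∃ n₀ : ℕ, ∀ n : ℕ, n₀ ≤ n → ∀ k : ℕ, 1 ≤ k → (k : ℝ) ≤ Real.logb 2 n - 2 →
      ((Finset.univ.filter
          (fun X : Fin n → Fin ⌊(2 : ℝ) ^ k / (β * k)⌋₊ × Fin ⌊(2 : ℝ) ^ (β * k)⌋₊ =>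
            ∀ b : Fin ⌊(2 : ℝ) ^ k / (β * k)⌋₊,
              ((((Finset.univ.filter (fun i => (X i).1 = b)).image
                  (fun i => (X i).2)).card : ℝ) ≤ β * k))).card : ℝ)
        / ((⌊(2 : ℝ) ^ k / (β * k)⌋₊ : ℝ) * (⌊(2 : ℝ) ^ (β * k)⌋₊ : ℝ)) ^ n
      < (n : ℝ) ^ (-a) := by
  obtain ⟨n₀, hn₀⟩ := Filter.eventually_atTop.1 (eventually_two_rpow_neg_div_four_lt_rpow_neg a)
  refine ⟨max n₀ 1, fun n hn k hk hkn => ?_⟩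
  have hn1 : 1 ≤ n := (le_max_right _ _).trans hn
  have hnpos : (0 : ℝ) < n := by exact_mod_cast hn1
  have hk1 : (1 : ℝ) ≤ k := by exact_mod_cast hk
  have hx : 1 ≤ β * k := by nlinarith
  have hs := two_mul_floor_le_floor_two_rpow hx
  have hfib : ⌊(2 : ℝ) ^ k / (β * k)⌋₊ * ⌊β * k⌋₊ ≤ 2 ^ k := by
    have h1 := Nat.floor_le (show (0 : ℝ) ≤ (2 : ℝ) ^ k / (β * k) by positivity)
    have h2 := Nat.floor_le (show (0 : ℝ) ≤ β * k by linarith)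
    have h3 := mul_le_mul h1 h2 (Nat.cast_nonneg _) (by positivity)
    rw [div_mul_cancel₀ _ (by positivity)] at h3
    exact_mod_cast h3
  have hkn' : 4 * 2 ^ k ≤ n := by
    have h1 : (k : ℝ) + 2 ≤ Real.logb 2 n := by linarith
    rw [Real.le_logb_iff_rpow_le one_lt_two hnpos, Real.rpow_add two_pos,
      Real.rpow_natCast] at h1
    have h2 : (4 : ℝ) * 2 ^ k ≤ n := by
      norm_num at h1
      linarith
    exact_mod_cast h2
  have hs1 : 1 ≤ ⌊β * k⌋₊ := (Nat.one_le_floor_iff _).2 hx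
  simp only [← Nat.le_floor_iff (show (0 : ℝ) ≤ β * k by linarith)]
  generalize ⌊(2 : ℝ) ^ k / (β * k)⌋₊ = m at *
  generalize ⌊(2 : ℝ) ^ (β * k)⌋₊ = L at *
  generalize ⌊β * k⌋₊ = s at *
  rcases Nat.eq_zero_or_pos m with rfl | hm
  · rw [Nat.cast_zero, zero_mul, zero_pow (by omega), div_zero]
    exact Real.rpow_pos_of_pos hnpos _
  refine lt_of_le_of_lt ?_ (hn₀ n ((le_max_left _ _).trans hn))
  have hcard : Fintype.card (Fin m × Fin L) = m * L := by simp
  have hNA : 2 * (m * s) ≤ m * L := by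
    calc 2 * (m * s) = m * (2 * s) := by ring
      _ ≤ m * L := Nat.mul_le_mul_left m hs
  refine le_trans ?_ (choose_mul_pow_div_pow_le (A := m * L) (N := m * s)
    (Nat.mul_pos hm (by omega)) hNA (by omega))
  rw [← Nat.cast_mul]
  gcongr
  norm_cast
  have hcount := card_filter_card_image_le (n := n) (N := m * s) (α := Fin m × Fin L)
    (by rw [hcard]; omega)
  rw [hcard] at hcount
  refine le_trans (Finset.card_le_card fun X hX => ?_) hcount
  simp only [Finset.mem_filter, Finset.mem_univ, true_and] at hX ⊢
  simpa using card_image_le_mul_of_card_fiber_image_le X s fun b => by convert hX b
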